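/- Let V be a finite-dimensional real vector space, g a positive-definite symmetric bilinear form on V, y ∈ V with y ≠ 0, and h(X,Z) := g(X,Z) − g(X,y)g(Z,y)/g(y,y) the angular metric. Let P be a symmetric trilinear form on V which is P-reducible, i.e., there is a linear functional p on V with P(X,Y,Z) = h(X,Y)p(Z) + h(Y,Z)p(X) + h(Z,X)p(Y) for all X,Y,Z ∈ V. If some vector B ∈ V, linearly independent from y, satisfies P(B,X,Y) = 0 for all X,Y ∈ V, then p = 0 and hence P = 0. -/

import Mathlib

/-- The angular metric of a positive-definite form is positive on vectors independent of `y`. -/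
theorem angular_metric_self_pos {V : Type*} [AddCommGroup V] [Module ℝ V]
    (g : V →ₗ[ℝ] V →ₗ[ℝ] ℝ) (hgsymm : ∀ X Z : V, g X Z = g Z X)
    (hgpos : ∀ X : V, X ≠ 0 → 0 < g X X) {y B : V} (hBy : LinearIndependent ℝ ![B, y]) :
    0 < g B B - g B y * g B y / g y y := by
  have hy : g y y ≠ 0 := (hgpos y (hBy.ne_zero 1)).ne'
  have hne : B - (g B y / g y y) • y ≠ 0 := fun hzero => by
    have := LinearIndependent.pair_iff.mp hBy 1 (-(g B y / g y y))
      (by rw [one_smul, neg_smul, ← sub_eq_add_neg, hzero])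
    exact one_ne_zero this.1
  have hpos := hgpos _ hne
  simp only [map_sub, map_smul, LinearMap.sub_apply, LinearMap.smul_apply, smul_eq_mul,
    hgsymm y B] at hpos
  convert hpos using 1
  field_simp
  ring

/-- Pointwise model of Theorem 3.5: a P-reducible symmetric trilinear form `P`
whose contraction with a vector `B` linearly independent from `y` vanishes
is identically zero (Landsberg condition). -/
theorem P_reducible_SC_implies_landsberg
    (V : Type*) [AddCommGroup V] [Module ℝ V] [FiniteDimensional ℝ V]
    (g : V →ₗ[ℝ] V →ₗ[ℝ] ℝ)
    (hgsymm : ∀ X Z : V, g X Z = g Z X)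
    (hgpos : ∀ X : V, X ≠ 0 → 0 < g X X)
    (y : V) (hy : y ≠ 0)
    (h : V → V → ℝ)
    (hdef : ∀ X Z : V, h X Z = g X Z - g X y * g Z y / g y y)
    (P : V →ₗ[ℝ] V →ₗ[ℝ] V →ₗ[ℝ] ℝ)
    (p : V →ₗ[ℝ] ℝ)
    (hPred : ∀ X Y Z : V, P X Y Z = h X Y * p Z + h Y Z * p X + h Z X * p Y)
    (B : V) (hBy : LinearIndependent ℝ ![B, y])
    (hSC : ∀ X Y : V, P B X Y = 0) :
    p = 0 ∧ P = 0 := by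
  have hBB : 0 < h B B := hdef B B ▸ angular_metric_self_pos g hgsymm hgpos hBy
  have hpB : p B = 0 := by
    have hcontr := hSC B B
    rw [hPred] at hcontr
    have : h B B * p B = 0 := by linarith
    exact (mul_eq_zero.mp this).resolve_left hBB.ne'
  have hp : p = 0 := by
    ext Y
    have hcontr := hSC B Y
    rw [hPred, hpB, mul_zero, mul_zero, add_zero, add_zero] at hcontr
    exact (mul_eq_zero.mp hcontr).resolve_left hBB.ne'
  refine ⟨hp, ?_⟩
  ext X Y Z
  simp [hPred, hp]
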